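/- In a commutative A-loop, the identity x^{-1}\((xy)\x) = y\((yx)\y)^{-1} holds for all x, y. -/

import Mathlib

/-- A commutative loop: commutative binary operation with two-sided identity
and a left division making all translations bijective. -/
class CommLoop (Q : Type*) extends Mul Q, One Q where
  mul_comm : ∀ x y : Q, x * y = y * x
  one_mul : ∀ x : Q, 1 * x = x
  mul_one : ∀ x : Q, x * 1 = x
  ldiv : Q → Q → Q
  mul_ldiv : ∀ x y : Q, x * ldiv x y = y
  ldiv_mul : ∀ x y : Q, ldiv x (x * y) = y

namespace CommLoop

variable {Q : Type*} [CommLoop Q]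

/-- The inverse `x⁻¹ = x \ 1`. -/
def inv (x : Q) : Q := ldiv x 1

/-- The inner mapping `L_{x,y} = L_x L_y L_{yx}⁻¹` (permutations acting on the right):
`z L_{x,y} = (yx) \ (y(xz))`. -/
def inn (x y z : Q) : Q := ldiv (y * x) (y * (x * z))

/-- Natural powers: `x^n = 1 L_x^n`. -/
def npow (x : Q) (n : ℕ) : Q := (fun y => x * y)^[n] 1

/-- Integer powers: `x^n = 1 L_x^n`. -/
def zpow (x : Q) : ℤ → Q
  | Int.ofNat n => npow x n
  | Int.negSucc n => (fun y => ldiv x y)^[n + 1] 1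

/-- A commutative A-loop: every inner mapping `L_{x,y}` is an automorphism. -/
class IsALoop (Q : Type*) [CommLoop Q] : Prop where
  inn_mul : ∀ x y u v : Q, inn x y (u * v) = inn x y u * inn x y v

/-- The left translation `L_x` as a permutation of `Q`. -/
def Le (x : Q) : Equiv.Perm Q :=
  ⟨fun y => x * y, fun y => ldiv x y, fun y => ldiv_mul x y, fun y => mul_ldiv x y⟩

/-- The permutation `P_x = L_x L_{x⁻¹}⁻¹`. -/
def Pe (x : Q) : Equiv.Perm Q := (Le x).trans (Le (inv x)).symm

end CommLoop

namespace CommLoop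

section

variable {Q : Type*} [CommLoop Q]

theorem mul_left_cancel {a b c : Q} (h : a * b = a * c) : b = c := by
  rw [← ldiv_mul a b, h, ldiv_mul]

theorem ldiv_eq_of_mul_eq {a b c : Q} (h : a * b = c) : ldiv a c = b := by
  rw [← h, ldiv_mul]

theorem mul_inv_self (a : Q) : a * inv a = 1 := mul_ldiv a 1

theorem inv_mul_self (a : Q) : inv a * a = 1 := by rw [mul_comm, mul_inv_self]

theorem inv_inv (a : Q) : inv (inv a) = a := ldiv_eq_of_mul_eq (inv_mul_self a)

theorem mul_inn (x y z : Q) : (y * x) * inn x y z = y * (x * z) := mul_ldiv _ _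

theorem inn_injective {x y u v : Q} (h : inn x y u = inn x y v) : u = v := by
  have h' := mul_inn x y u
  rw [h, mul_inn] at h'
  exact (mul_left_cancel (mul_left_cancel h')).symm

theorem inn_one (x y : Q) : inn x y 1 = 1 :=
  ldiv_eq_of_mul_eq (by rw [mul_one, mul_one])

/-- The inner mapping `L_{x,y}` fixes `y`. -/
theorem inn_self_right (x y : Q) : inn x y y = y :=
  ldiv_eq_of_mul_eq (by rw [mul_comm (y * x) y, mul_comm x y])

theorem inn_inv_left (x y : Q) : inn x y (inv x) = ldiv (y * x) y := by
  rw [inn, mul_inv_self, mul_one]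

variable [IsALoop Q]

theorem inn_ldiv (x y u v : Q) : inn x y (ldiv u v) = ldiv (inn x y u) (inn x y v) :=
  (ldiv_eq_of_mul_eq (by rw [← IsALoop.inn_mul, mul_ldiv])).symm

theorem inn_inv (x y u : Q) : inn x y (inv u) = inv (inn x y u) := by
  rw [inv, inn_ldiv, inn_one, inv]

/-- The automorphic inverse property. -/
theorem inv_mul_inv (x y : Q) : inv x * inv y = inv (x * y) := by
  set p := x * y with hp
  have fix : inn y (inv p) (inv p) = inv p := inn_self_right _ _
  have hx : inn y (inv p) x = inv (inv p * y) := by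
    rw [inn, mul_comm y x, ← hp, inv_mul_self]; rfl
  apply inn_injective (x := y) (y := inv p)
  rw [IsALoop.inn_mul, fix, inn_inv, hx, inv_inv, inn_inv_left, mul_ldiv]

theorem inv_ldiv_inv (x y : Q) : ldiv (inv x) (inv y) = inv (ldiv x y) :=
  ldiv_eq_of_mul_eq (by rw [inv_mul_inv, mul_ldiv])

/-- `L_u` and `L_{u⁻¹}` commute. -/
theorem inv_mul_mul (u z : Q) : inv u * (u * z) = u * (inv u * z) := by
  have h (w : Q) : inn (inv u) u w = u * (inv u * w) :=
    ldiv_eq_of_mul_eq (by rw [mul_inv_self, one_mul])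
  have h' := IsALoop.inn_mul (inv u) u u z
  rw [inn_self_right, h, h] at h'
  exact mul_left_cancel h'

theorem mul_mul_ldiv_swap (x y : Q) :
    y * (x * ldiv y x) = x * (y * inv (ldiv x y)) := by
  obtain ⟨u, rfl⟩ : ∃ u, y = x * u := ⟨ldiv x y, (mul_ldiv x y).symm⟩
  have h : x * ldiv (x * u) x = inn u x (x * inv u) := by
    rw [IsALoop.inn_mul, inn_self_right, inn_inv_left]
  rw [h, mul_inn, ldiv_mul, mul_comm x (inv u), ← inv_mul_mul, mul_comm (x * u), mul_comm x u]

end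

end CommLoop

open CommLoop in
/-- `x⁻¹ \ ((xy) \ x) = y \ ((yx) \ y)⁻¹`. -/
theorem stmt16 {Q : Type*} [CommLoop Q] [IsALoop Q] (x y : Q) :
    ldiv (inv x) (ldiv (x * y) x) = ldiv y (inv (ldiv (y * x) y)) := by
  have hl : ldiv (inv x) (ldiv (x * y) x) = inn y x (ldiv (inv x) (inv y)) := by
    rw [inn_ldiv, inn_inv y x x, inn_self_right, inn_inv_left]
  have hr : ldiv y (inv (ldiv (y * x) y)) = inn x y (ldiv y x) := by
    rw [inn_ldiv, inn_self_right, ← inn_inv_left, inn_inv, CommLoop.inv_inv]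
  rw [hl, hr, inv_ldiv_inv, inn, inn, mul_mul_ldiv_swap, CommLoop.mul_comm x y]
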